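/- arXiv:2511.04515 — 2 statements merged into one kernel-verified Lean document; each statement's English description precedes it below -/
import Mathlib

section
/- Let S and A be compact Polish spaces. For any probability measures μ on S, ζ on A, μ̃ on S, ζ̃ on A, and any coupling Λ of (μ, ζ) on S×A, there exists a coupling Λ̃* of (μ̃, ζ̃) on S×A such that the 1-Wasserstein distance W(Λ, Λ̃*) on P(S×A) is at most W(μ, μ̃) + W(ζ, ζ̃), where the metric on S×A is d_S + d_A. -/
open MeasureTheory

/-- 1-Wasserstein distance between two (probability) measures on a metric measurable
space, defined as the infimum over all couplings of the mean distance. -/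
noncomputable def W1 {X : Type*} [MeasurableSpace X] [PseudoMetricSpace X]
    (μ ν : Measure X) : ℝ :=
  sInf {r : ℝ | ∃ γ : Measure (X × X), IsProbabilityMeasure γ ∧
    γ.map Prod.fst = μ ∧ γ.map Prod.snd = ν ∧ r = ∫ p, dist p.1 p.2 ∂γ}

/-- 1-Wasserstein distance on `P(S × A)` where `S × A` carries the sum metric
`d_{S×A}((s,a),(s',a')) = d_S(s,s') + d_A(a,a')`. -/
noncomputable def W1sum {S A : Type*} [MeasurableSpace S] [PseudoMetricSpace S]
    [MeasurableSpace A] [PseudoMetricSpace A] (Λ Λ' : Measure (S × A)) : ℝ :=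
  sInf {r : ℝ | ∃ γ : Measure ((S × A) × (S × A)), IsProbabilityMeasure γ ∧
    γ.map Prod.fst = Λ ∧ γ.map Prod.snd = Λ' ∧
    r = ∫ q, (dist q.1.1 q.2.1 + dist q.1.2 q.2.2) ∂γ}

open ProbabilityTheory

theorem exists_opt_aux {X : Type*} [MetricSpace X] [CompactSpace X] [MeasurableSpace X]
    [BorelSpace X] (μ ν : Measure X) [IsProbabilityMeasure μ] [IsProbabilityMeasure ν] :
    ∃ γ : Measure (X × X), IsProbabilityMeasure γ ∧
    γ.map Prod.fst = μ ∧ γ.map Prod.snd = ν ∧ ∫ p, dist p.1 p.2 ∂γ = W1 μ ν := by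
  let μ0 : ProbabilityMeasure X := ⟨μ, inferInstance⟩
  let ν0 : ProbabilityMeasure X := ⟨ν, inferInstance⟩
  let F : ProbabilityMeasure (X × X) → ProbabilityMeasure X :=
    fun γ => γ.map (measurable_fst.aemeasurable)
  let G : ProbabilityMeasure (X × X) → ProbabilityMeasure X :=
    fun γ => γ.map (measurable_snd.aemeasurable)
  have hF : Continuous F := ProbabilityMeasure.continuous_map continuous_fst
  have hG : Continuous G := ProbabilityMeasure.continuous_map continuous_snd
  let K : Set (ProbabilityMeasure (X × X)) := F ⁻¹' {μ0} ∩ G ⁻¹' {ν0}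
  have hK : IsCompact K :=
    ((isClosed_singleton.preimage hF).inter (isClosed_singleton.preimage hG)).isCompact
  let d : BoundedContinuousFunction (X × X) ℝ :=
    BoundedContinuousFunction.mkOfCompact ⟨fun p => dist p.1 p.2, continuous_dist⟩
  have hI : Continuous (fun γ : ProbabilityMeasure (X × X) => ∫ p, d p ∂(γ : Measure (X × X))) :=
    ProbabilityMeasure.continuous_integral_boundedContinuousFunction d
  have hne : K.Nonempty := by
    refine ⟨⟨μ.prod ν, inferInstance⟩, ?_, ?_⟩
    · apply Subtype.ext
      change (μ.prod ν).map Prod.fst = μ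
      simp [Measure.map_fst_prod]
    · apply Subtype.ext
      change (μ.prod ν).map Prod.snd = ν
      simp [Measure.map_snd_prod]
  have hs := (hK.image hI).sInf_mem (hne.image _)
  have hset : (fun γ : ProbabilityMeasure (X × X) => ∫ p, d p ∂(γ : Measure (X × X))) '' K =
      {r : ℝ | ∃ γ : Measure (X × X), IsProbabilityMeasure γ ∧
        γ.map Prod.fst = μ ∧ γ.map Prod.snd = ν ∧ r = ∫ p, dist p.1 p.2 ∂γ} := by
    ext r
    constructor
    · rintro ⟨γ, ⟨h1, h2⟩, rfl⟩
      exact ⟨γ, inferInstance, congrArg Subtype.val h1, congrArg Subtype.val h2, rfl⟩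
    · rintro ⟨γ, hp, h1, h2, rfl⟩
      exact ⟨⟨γ, hp⟩, ⟨Subtype.ext h1, Subtype.ext h2⟩, rfl⟩
  rw [hset] at hs
  obtain ⟨γ, hp, h1, h2, h3⟩ := hs
  exact ⟨γ, hp, h1, h2, h3.symm⟩

theorem glue_fst_aux {S A : Type*} [MeasurableSpace S] [MeasurableSpace A]
    (Λ : Measure (S × A)) [IsProbabilityMeasure Λ]
    (κ : Kernel S S) [IsMarkovKernel κ] (η : Kernel A A) [IsMarkovKernel η] :
    (Λ ⊗ₘ (κ ∥ₖ η)).map (fun q => (q.1.1, q.2.1)) = (Λ.map Prod.fst) ⊗ₘ κ := by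
  have : IsProbabilityMeasure (Λ.map Prod.fst) :=
    Measure.isProbabilityMeasure_map measurable_fst.aemeasurable
  refine Measure.ext_of_lintegral _ fun f hf => ?_
  rw [lintegral_map hf (by fun_prop), Measure.lintegral_compProd (by fun_prop),
    Measure.lintegral_compProd hf, lintegral_map (hf.lintegral_kernel_prod_right') measurable_fst]
  refine lintegral_congr fun p => ?_
  rw [Kernel.parallelComp_apply, lintegral_prod _ (by fun_prop)]
  simp

theorem glue_snd_aux {S A : Type*} [MeasurableSpace S] [MeasurableSpace A]
    (Λ : Measure (S × A)) [IsProbabilityMeasure Λ]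
    (κ : Kernel S S) [IsMarkovKernel κ] (η : Kernel A A) [IsMarkovKernel η] :
    (Λ ⊗ₘ (κ ∥ₖ η)).map (fun q => (q.1.2, q.2.2)) = (Λ.map Prod.snd) ⊗ₘ η := by
  have : IsProbabilityMeasure (Λ.map Prod.snd) :=
    Measure.isProbabilityMeasure_map measurable_snd.aemeasurable
  refine Measure.ext_of_lintegral _ fun f hf => ?_
  rw [lintegral_map hf (by fun_prop), Measure.lintegral_compProd (by fun_prop),
    Measure.lintegral_compProd hf, lintegral_map (hf.lintegral_kernel_prod_right') measurable_snd]
  refine lintegral_congr fun p => ?_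
  rw [Kernel.parallelComp_apply, lintegral_prod _ (by fun_prop)]
  simp

/-- coupling lemma. Given a coupling `Λ` of `(μ, ζ)` on `S × A`
(with `S`, `A` compact Polish), and any other pair `(μ', ζ')`, there exists a
coupling `Λ'` of `(μ', ζ')` with `W(Λ, Λ') ≤ W(μ, μ') + W(ζ, ζ')`. -/
theorem stmt_0 {S A : Type*}
    [MetricSpace S] [CompactSpace S] [MeasurableSpace S] [BorelSpace S]
    [MetricSpace A] [CompactSpace A] [MeasurableSpace A] [BorelSpace A]
    (μ μ' : Measure S) (ζ ζ' : Measure A)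
    [IsProbabilityMeasure μ] [IsProbabilityMeasure μ']
    [IsProbabilityMeasure ζ] [IsProbabilityMeasure ζ']
    (Λ : Measure (S × A)) [IsProbabilityMeasure Λ]
    (h1 : Λ.map Prod.fst = μ) (h2 : Λ.map Prod.snd = ζ) :
    ∃ Λ' : Measure (S × A), IsProbabilityMeasure Λ' ∧
      Λ'.map Prod.fst = μ' ∧ Λ'.map Prod.snd = ζ' ∧
      W1sum Λ Λ' ≤ W1 μ μ' + W1 ζ ζ' := by
  have : Nonempty S := nonempty_of_isProbabilityMeasure μ
  have : Nonempty A := nonempty_of_isProbabilityMeasure ζ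
  obtain ⟨γ, hγ, hγ1, hγ2, hγ3⟩ := exists_opt_aux μ μ'
  obtain ⟨δ, hδ, hδ1, hδ2, hδ3⟩ := exists_opt_aux ζ ζ'
  let Γ := Λ ⊗ₘ (γ.condKernel ∥ₖ δ.condKernel)
  have e1 : Γ.map (fun q => (q.1.1, q.2.1)) = γ := by
    rw [glue_fst_aux, h1, ← hγ1]
    exact γ.disintegrate γ.condKernel
  have e2 : Γ.map (fun q => (q.1.2, q.2.2)) = δ := by
    rw [glue_snd_aux, h2, ← hδ1]
    exact δ.disintegrate δ.condKernel
  refine ⟨Γ.map Prod.snd, Measure.isProbabilityMeasure_map measurable_snd.aemeasurable, ?_, ?_, ?_⟩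
  · rw [← hγ2, ← e1, Measure.map_map (by fun_prop) (by fun_prop),
      Measure.map_map (by fun_prop) (by fun_prop)]
    rfl
  · rw [← hδ2, ← e2, Measure.map_map (by fun_prop) (by fun_prop),
      Measure.map_map (by fun_prop) (by fun_prop)]
    rfl
  · refine csInf_le ⟨0, ?_⟩ ⟨Γ, inferInstance, Measure.fst_compProd _ _, rfl, ?_⟩
    · rintro r ⟨g, -, -, -, rfl⟩
      exact integral_nonneg fun q => by positivity
    · have iS : Integrable (fun p : S × S => dist p.1 p.2) γ :=
        (BoundedContinuousFunction.mkOfCompact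
          (⟨fun p => dist p.1 p.2, continuous_dist⟩ : C(S × S, ℝ))).integrable γ
      have iA : Integrable (fun p : A × A => dist p.1 p.2) δ :=
        (BoundedContinuousFunction.mkOfCompact
          (⟨fun p => dist p.1 p.2, continuous_dist⟩ : C(A × A, ℝ))).integrable δ
      have m1 : AEMeasurable (fun q : (S × A) × (S × A) => (q.1.1, q.2.1)) Γ := by fun_prop
      have m2 : AEMeasurable (fun q : (S × A) × (S × A) => (q.1.2, q.2.2)) Γ := by fun_prop
      rw [← e1] at iS
      rw [← e2] at iA
      refine Eq.trans ?_ (integral_add (iS.comp_aemeasurable m1) (iA.comp_aemeasurable m2)).symm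
      rw [← hγ3, ← hδ3]
      congr 1
      · conv_lhs => rw [← e1]
        exact integral_map m1 iS.1
      · conv_lhs => rw [← e2]
        exact integral_map m2 iA.1
end

section
/- Let S and A be compact Polish spaces. The coupling correspondence Cpl : P(S) × P(A) → P(S×A), mapping (μ, ζ) to the set of all couplings of μ and ζ, is lower hemicontinuous: for every (μ, ζ), every coupling Λ of (μ, ζ), and every sequence (μⁿ, ζⁿ) converging weakly to (μ, ζ), there exist couplings Λⁿ of (μⁿ, ζⁿ) converging weakly to Λ. -/
open MeasureTheory


theorem aux_int {X : Type*} [MetricSpace X] [CompactSpace X] [MeasurableSpace X] [BorelSpace X]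
    (μ : Measure X) [IsFiniteMeasure μ] {f : X → ℝ} (hf : Continuous f) : Integrable f μ :=
  hf.integrable_of_hasCompactSupport (HasCompactSupport.of_compactSpace f)

theorem aux_complete {S A : Type*} [MeasurableSpace S] [MeasurableSpace A]
    (μ : Measure S) [IsProbabilityMeasure μ] (ζ : Measure A) [IsProbabilityMeasure ζ]
    (M : Measure (S × A)) (h1 : M.map Prod.fst ≤ μ) (h2 : M.map Prod.snd ≤ ζ) :
    ∃ R : Measure (S × A), (M + R).map Prod.fst = μ ∧ (M + R).map Prod.snd = ζ := by
  have hM1 : (M.map Prod.fst) Set.univ = M Set.univ := by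
    rw [Measure.map_apply measurable_fst MeasurableSet.univ]; simp
  have hM2 : (M.map Prod.snd) Set.univ = M Set.univ := by
    rw [Measure.map_apply measurable_snd MeasurableSet.univ]; simp
  have hM : IsFiniteMeasure M := ⟨by
    rw [← hM1]; exact (h1 Set.univ).trans_lt (measure_lt_top _ _)⟩
  have e1 := Measure.sub_add_cancel_of_le h1
  have e2 := Measure.sub_add_cancel_of_le h2
  have m1 : (μ - M.map Prod.fst) Set.univ = 1 - M Set.univ := by
    rw [Measure.sub_apply MeasurableSet.univ h1, hM1, measure_univ]
  have m2 : (ζ - M.map Prod.snd) Set.univ = 1 - M Set.univ := by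
    rw [Measure.sub_apply MeasurableSet.univ h2, hM2, measure_univ]
  have f1 : IsFiniteMeasure (μ - M.map Prod.fst) := isFiniteMeasure_of_le μ Measure.sub_le
  have f2 : IsFiniteMeasure (ζ - M.map Prod.snd) := isFiniteMeasure_of_le ζ Measure.sub_le
  refine ⟨(1 - M Set.univ)⁻¹ • (μ - M.map Prod.fst).prod (ζ - M.map Prod.snd), ?_, ?_⟩
  · rw [Measure.map_add _ _ measurable_fst, Measure.map_smul, Measure.map_fst_prod, m2, smul_smul]
    by_cases hr : 1 - M Set.univ = 0
    · rw [hr] at m1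
      rw [Measure.measure_univ_eq_zero.1 m1] at e1 ⊢
      simpa using e1
    · rw [ENNReal.inv_mul_cancel hr (by simp), one_smul, add_comm, e1]
  · rw [Measure.map_add _ _ measurable_snd, Measure.map_smul, Measure.map_snd_prod, m1, smul_smul]
    by_cases hr : 1 - M Set.univ = 0
    · rw [hr] at m2
      rw [Measure.measure_univ_eq_zero.1 m2] at e2 ⊢
      simpa using e2
    · rw [ENNReal.inv_mul_cancel hr (by simp), one_smul, add_comm, e2]

theorem aux_density {S A : Type*}
    [MetricSpace S] [CompactSpace S] [MeasurableSpace S] [BorelSpace S]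
    [MetricSpace A] [CompactSpace A] [MeasurableSpace A] [BorelSpace A]
    (μ : ProbabilityMeasure S) (ζ : ProbabilityMeasure A) (H : S × A → ℝ) (hH : Continuous H)
    (h0 : ∀ p, 0 ≤ H p) (h1 : ∀ x, ∫ y, H (x, y) ∂(ζ : Measure A) ≤ 1)
    (h2 : ∀ y, ∫ x, H (x, y) ∂(μ : Measure S) ≤ 1) :
    ∃ Λ : ProbabilityMeasure (S × A), (Λ : Measure (S × A)).map Prod.fst = (μ : Measure S) ∧
      (Λ : Measure (S × A)).map Prod.snd = (ζ : Measure A) ∧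
      ∀ (f : S × A → ℝ) (C : ℝ), Continuous f → (∀ p, |f p| ≤ C) →
        |∫ p, f p ∂(Λ : Measure (S × A)) - ∫ p, H p * f p ∂((μ.prod ζ : ProbabilityMeasure (S × A)) : Measure (S × A))|
          ≤ C * (1 - ∫ p, H p ∂((μ.prod ζ : ProbabilityMeasure (S × A)) : Measure (S × A))) := by
  set P : Measure (S × A) := ((μ.prod ζ : ProbabilityMeasure (S × A)) : Measure (S × A)) with hP
  have hPe : P = (μ : Measure S).prod (ζ : Measure A) := rfl
  have hHm : Measurable fun p => ENNReal.ofReal (H p) := hH.measurable.ennreal_ofReal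
  set M := P.withDensity fun p => ENNReal.ofReal (H p) with hM
  have a1 : M.map Prod.fst ≤ (μ : Measure S) := by
    refine Measure.le_iff.2 fun B hB => ?_
    rw [Measure.map_apply measurable_fst hB, hM, withDensity_apply _ (measurable_fst hB), hPe,
      ← Set.prod_univ, setLIntegral_prod _ hHm.aemeasurable]
    calc _ ≤ ∫⁻ x in B, 1 ∂(μ : Measure S) := by
          refine lintegral_mono fun x => ?_
          rw [setLIntegral_univ, ← ofReal_integral_eq_lintegral_ofReal
            (aux_int _ (by fun_prop)) (Filter.Eventually.of_forall fun y => h0 _)]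
          simpa using h1 x
      _ = _ := by simp
  have a2 : M.map Prod.snd ≤ (ζ : Measure A) := by
    refine Measure.le_iff.2 fun B hB => ?_
    rw [Measure.map_apply measurable_snd hB, hM, withDensity_apply _ (measurable_snd hB), hPe,
      ← Set.univ_prod, setLIntegral_prod_symm _ hHm.aemeasurable]
    calc _ ≤ ∫⁻ x in B, 1 ∂(ζ : Measure A) := by
          refine lintegral_mono fun x => ?_
          rw [setLIntegral_univ, ← ofReal_integral_eq_lintegral_ofReal
            (aux_int _ (by fun_prop)) (Filter.Eventually.of_forall fun y => h0 _)]
          simpa using h2 x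
      _ = _ := by simp
  obtain ⟨R, r1, r2⟩ := aux_complete _ _ M a1 a2
  have hprob : IsProbabilityMeasure (M + R) := ⟨by
    have : ((M + R).map Prod.fst) Set.univ = (M + R) Set.univ := by
      rw [Measure.map_apply measurable_fst MeasurableSet.univ]; simp
    rw [← this, r1]; simp⟩
  have fM : IsFiniteMeasure M := isFiniteMeasure_of_le (M + R) (Measure.le_add_right le_rfl)
  have fR : IsFiniteMeasure R := isFiniteMeasure_of_le (M + R) (Measure.le_add_left le_rfl)
  have key : ∀ f : S × A → ℝ, ∫ p, f p ∂M = ∫ p, H p * f p ∂P := by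
    intro f
    rw [hM, integral_withDensity_eq_integral_toReal_smul hHm (by simp)]
    refine integral_congr_ae (Filter.Eventually.of_forall fun p => ?_)
    simp [ENNReal.toReal_ofReal (h0 p)]
  refine ⟨⟨M + R, hprob⟩, r1, r2, fun f C hf hC => ?_⟩
  have hR : R.real Set.univ = 1 - ∫ p, H p ∂P := by
    have k1 := key (fun _ => 1)
    have k2 : ∫ p, (1:ℝ) ∂(M + R) = 1 := by simp
    rw [integral_add_measure (by simp) (by simp), k1] at k2
    simp at k2
    linarith
  have : ∫ p, f p ∂(M + R) - ∫ p, H p * f p ∂P = ∫ p, f p ∂(R) := by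
    rw [integral_add_measure (aux_int _ hf) (aux_int _ hf), key]; ring
  rw [ProbabilityMeasure.coe_mk, this, ← hR]
  exact norm_integral_le_of_norm_le_const (f := f) (μ := R) (C := C)
    (Filter.Eventually.of_forall hC)

theorem aux_pou {X : Type*} [MetricSpace X] [CompactSpace X] (ε : ℝ) (hε : 0 < ε) :
    ∃ (t : Finset X) (φ : t → X → ℝ), (∀ i, Continuous (φ i)) ∧ (∀ i x, 0 ≤ φ i x) ∧
      (∀ x, ∑ i, φ i x = 1) ∧ ∀ i x x', φ i x ≠ 0 → φ i x' ≠ 0 → dist x x' < ε := by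
  obtain ⟨t, -, hfin, ht⟩ := finite_cover_balls_of_compact (isCompact_univ (X := X)) (half_pos hε)
  lift t to Finset X using hfin
  let g : t → X → ℝ := fun i x => max 0 (ε / 2 - dist x i)
  have g0 : ∀ i x, 0 ≤ g i x := fun i x => le_max_left _ _
  have gc : ∀ i, Continuous (g i) := fun i => by fun_prop
  have gs : ∀ x, 0 < ∑ i, g i x := by
    intro x
    obtain ⟨i, hi, hx⟩ := Set.mem_iUnion₂.1 (ht (Set.mem_univ x))
    refine Finset.sum_pos' (fun i _ => g0 i x) ⟨⟨i, hi⟩, Finset.mem_univ _, ?_⟩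
    exact lt_max_of_lt_right (by simpa using hx)
  have gn : ∀ i x, g i x ≠ 0 → dist x i < ε / 2 := by
    intro i x h
    by_contra hc
    exact h (max_eq_left (by linarith))
  refine ⟨t, fun i x => g i x / ∑ j, g j x, fun i => ?_, fun i x => ?_, fun x => ?_, ?_⟩
  · exact (gc i).div (by fun_prop) fun x => (gs x).ne'
  · exact div_nonneg (g0 i x) (gs x).le
  · rw [← Finset.sum_div, div_self (gs x).ne']
  · intro i x x' hx hx'
    have a := gn i x (by rintro h; simp [h] at hx)
    have b := gn i x' (by rintro h; simp [h] at hx')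
    linarith [dist_triangle_right x x' (i : X)]

theorem aux_cell {X : Type*} [MetricSpace X] [CompactSpace X] [MeasurableSpace X] [BorelSpace X]
    (Q : Measure X) [IsFiniteMeasure Q] {w f : X → ℝ} (hw : Continuous w) (hf : Continuous f)
    (w0 : ∀ p, 0 ≤ w p) (v η : ℝ) (h : ∀ p, w p ≠ 0 → |f p - v| ≤ η) :
    |∫ p, w p * f p ∂Q - v * ∫ p, w p ∂Q| ≤ η * ∫ p, w p ∂Q := by
  rw [← integral_const_mul, ← integral_const_mul,
    ← integral_sub (aux_int _ (by fun_prop)) (aux_int _ (by fun_prop))]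
  refine (abs_integral_le_integral_abs).trans
    (integral_mono (aux_int _ (by fun_prop)) (aux_int _ (by fun_prop)) fun p => ?_)
  by_cases hp : w p = 0
  · simp [hp]
  · have : w p * f p - v * w p = (f p - v) * w p := by ring
    simp only [this, abs_mul, abs_of_nonneg (w0 p)]
    exact mul_le_mul_of_nonneg_right (h p hp) (w0 p)

theorem aux_seq {S A : Type*}
    [MetricSpace S] [CompactSpace S] [MeasurableSpace S] [BorelSpace S]
    [MetricSpace A] [CompactSpace A] [MeasurableSpace A] [BorelSpace A]
    (μ : ProbabilityMeasure S) (ζ : ProbabilityMeasure A)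
    (μn : ℕ → ProbabilityMeasure S) (ζn : ℕ → ProbabilityMeasure A)
    (hμ : Filter.Tendsto μn Filter.atTop (nhds μ))
    (hζ : Filter.Tendsto ζn Filter.atTop (nhds ζ))
    {ι κ : Type*} [Fintype ι] [Fintype κ] (φ : ι → S → ℝ) (ψ : κ → A → ℝ)
    (φc : ∀ i, Continuous (φ i)) (ψc : ∀ i, Continuous (ψ i))
    (φ0 : ∀ i x, 0 ≤ φ i x) (ψ0 : ∀ i x, 0 ≤ ψ i x)
    (φ1 : ∀ x, ∑ i, φ i x = 1) (ψ1 : ∀ x, ∑ i, ψ i x = 1)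
    (c : ι → κ → ℝ) (c0 : ∀ i j, 0 ≤ c i j)
    (h1 : ∀ i, ∑ j, c i j * ∫ y, ψ j y ∂(ζ : Measure A) ≤ 1)
    (h2 : ∀ j, ∑ i, c i j * ∫ x, φ i x ∂(μ : Measure S) ≤ 1)
    (h3 : ∫ p, (∑ i, ∑ j, c i j * (φ i p.1 * ψ j p.2))
      ∂((μ.prod ζ : ProbabilityMeasure (S × A)) : Measure (S × A)) = 1) :
    ∃ Λn : ℕ → ProbabilityMeasure (S × A),
      (∀ n, (Λn n : Measure (S × A)).map Prod.fst = (μn n : Measure S) ∧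
            (Λn n : Measure (S × A)).map Prod.snd = (ζn n : Measure A)) ∧
      ∀ f : S × A → ℝ, Continuous f →
        Filter.Tendsto (fun n => ∫ p, f p ∂(Λn n : Measure (S × A))) Filter.atTop
          (nhds (∫ p, (∑ i, ∑ j, c i j * (φ i p.1 * ψ j p.2)) * f p
            ∂((μ.prod ζ : ProbabilityMeasure (S × A)) : Measure (S × A)))) := by
  have tend : ∀ {X : Type _} [MetricSpace X] [CompactSpace X] [MeasurableSpace X] [BorelSpace X]
      {Q : ProbabilityMeasure X} {Qn : ℕ → ProbabilityMeasure X}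
      (_ : Filter.Tendsto Qn Filter.atTop (nhds Q)) {f : X → ℝ} (_ : Continuous f),
      Filter.Tendsto (fun n => ∫ p, f p ∂(Qn n : Measure X)) Filter.atTop
        (nhds (∫ p, f p ∂(Q : Measure X))) := by
    intro X _ _ _ _ Q Qn h f hf
    exact ProbabilityMeasure.tendsto_iff_forall_integral_tendsto.1 h
      (BoundedContinuousFunction.mkOfCompact ⟨f, hf⟩)
  have tendS : ∀ i, Filter.Tendsto (fun n => ∫ x, φ i x ∂(μn n : Measure S)) Filter.atTop
        (nhds (∫ x, φ i x ∂(μ : Measure S))) := fun i =>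
    ProbabilityMeasure.tendsto_iff_forall_integral_tendsto.1 hμ
      (BoundedContinuousFunction.mkOfCompact ⟨φ i, φc i⟩)
  have tendA : ∀ i, Filter.Tendsto (fun n => ∫ x, ψ i x ∂(ζn n : Measure A)) Filter.atTop
        (nhds (∫ x, ψ i x ∂(ζ : Measure A))) := fun i =>
    ProbabilityMeasure.tendsto_iff_forall_integral_tendsto.1 hζ
      (BoundedContinuousFunction.mkOfCompact ⟨ψ i, ψc i⟩)
  have hprod : Filter.Tendsto (fun n => (μn n).prod (ζn n)) Filter.atTop (nhds (μ.prod ζ)) :=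
    (ProbabilityMeasure.continuous_prod.tendsto (μ, ζ)).comp (hμ.prodMk_nhds hζ)
  set h : S × A → ℝ := fun p => ∑ i, ∑ j, c i j * (φ i p.1 * ψ j p.2) with hh
  have hc : Continuous h := by fun_prop
  have hnn : ∀ p, 0 ≤ h p := fun p => Finset.sum_nonneg fun i _ => Finset.sum_nonneg fun j _ =>
    mul_nonneg (c0 i j) (mul_nonneg (φ0 _ _) (ψ0 _ _))
  let a : ι → ℕ → ℝ := fun i n => ∑ j, c i j * ∫ y, ψ j y ∂(ζn n : Measure A)
  let a' : ι → ℝ := fun i => ∑ j, c i j * ∫ y, ψ j y ∂(ζ : Measure A)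
  let b : κ → ℕ → ℝ := fun j n => ∑ i, c i j * ∫ x, φ i x ∂(μn n : Measure S)
  let b' : κ → ℝ := fun j => ∑ i, c i j * ∫ x, φ i x ∂(μ : Measure S)
  have ta : ∀ i, Filter.Tendsto (a i) Filter.atTop (nhds (a' i)) := fun i =>
    tendsto_finsetSum _ fun j _ => (tendA j).const_mul _
  have tb : ∀ i, Filter.Tendsto (b i) Filter.atTop (nhds (b' i)) := fun i =>
    tendsto_finsetSum _ fun j _ => (tendS j).const_mul _
  let s : ℕ → ℝ := fun n => 1 + ∑ i, |a i n - a' i| + ∑ j, |b j n - b' j|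
  have ts : Filter.Tendsto s Filter.atTop (nhds 1) := by
    have e1 : Filter.Tendsto (fun n => ∑ i, |a i n - a' i|) Filter.atTop
        (nhds (∑ i : ι, |a' i - a' i|)) :=
      tendsto_finsetSum _ fun i _ => ((ta i).sub_const _).abs
    have e2 : Filter.Tendsto (fun n => ∑ i, |b i n - b' i|) Filter.atTop
        (nhds (∑ i : κ, |b' i - b' i|)) :=
      tendsto_finsetSum _ fun i _ => ((tb i).sub_const _).abs
    simpa using (e1.const_add 1).add e2
  have sa0 : ∀ n, 0 ≤ ∑ i, |a i n - a' i| := fun n => Finset.sum_nonneg fun i _ => abs_nonneg _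
  have sb0 : ∀ n, 0 ≤ ∑ i, |b i n - b' i| := fun n => Finset.sum_nonneg fun i _ => abs_nonneg _
  have s1 : ∀ n, 0 < s n := fun n => by have := sa0 n; have := sb0 n; positivity
  have sa : ∀ i n, a i n ≤ s n := fun i n => by
    have e := Finset.single_le_sum (f := fun i => |a i n - a' i|) (fun i _ => abs_nonneg _)
      (Finset.mem_univ i)
    have := le_abs_self (a i n - a' i)
    have : a' i ≤ 1 := h1 i
    have := sb0 n
    simp only [s]; linarith
  have sb : ∀ i n, b i n ≤ s n := fun i n => by
    have e := Finset.single_le_sum (f := fun i => |b i n - b' i|) (fun i _ => abs_nonneg _)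
      (Finset.mem_univ i)
    have := le_abs_self (b i n - b' i)
    have : b' i ≤ 1 := h2 i
    have := sa0 n
    simp only [s]; linarith
  have main := fun n => aux_density (μn n) (ζn n) (fun p => (s n)⁻¹ * h p) (by fun_prop)
    (fun p => mul_nonneg (inv_nonneg.2 (s1 n).le) (hnn p))
    (fun x => by
      rw [integral_const_mul, inv_mul_le_iff₀ (s1 n), mul_one]
      have : ∫ y, h (x, y) ∂(ζn n : Measure A) = ∑ i, φ i x * a i n := by
        simp only [hh, a, Finset.mul_sum]
        rw [integral_finsetSum _ fun i _ => aux_int _ (by fun_prop)]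
        refine Finset.sum_congr rfl fun i _ => ?_
        rw [integral_finsetSum _ fun i _ => aux_int _ (by fun_prop)]
        refine Finset.sum_congr rfl fun j _ => ?_
        rw [integral_const_mul, integral_const_mul]; ring
      rw [this]
      calc _ ≤ ∑ i, φ i x * s n := Finset.sum_le_sum fun i _ =>
              mul_le_mul_of_nonneg_left (sa i n) (φ0 i x)
        _ = s n := by rw [← Finset.sum_mul, φ1, one_mul])
    (fun y => by
      rw [integral_const_mul, inv_mul_le_iff₀ (s1 n), mul_one]
      have : ∫ x, h (x, y) ∂(μn n : Measure S) = ∑ j, ψ j y * b j n := by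
        simp only [hh, b, Finset.mul_sum]
        rw [Finset.sum_comm, integral_finsetSum _ fun i _ => aux_int _ (by fun_prop)]
        refine Finset.sum_congr rfl fun i _ => ?_
        rw [integral_finsetSum _ fun i _ => aux_int _ (by fun_prop)]
        refine Finset.sum_congr rfl fun j _ => ?_
        rw [integral_const_mul, integral_mul_const]; ring
      rw [this]
      calc _ ≤ ∑ i, ψ i y * s n := Finset.sum_le_sum fun i _ =>
              mul_le_mul_of_nonneg_left (sb i n) (ψ0 i y)
        _ = s n := by rw [← Finset.sum_mul, ψ1, one_mul])
  choose Λn m1 m2 m3 using main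
  refine ⟨Λn, fun n => ⟨m1 n, m2 n⟩, fun f hf => ?_⟩
  obtain ⟨C, hC⟩ : ∃ C, ∀ p, |f p| ≤ C := by
    obtain ⟨C, hC⟩ := (isCompact_range hf.abs).bddAbove
    exact ⟨C, fun p => hC ⟨p, rfl⟩⟩
  have tsi : Filter.Tendsto (fun n => (s n)⁻¹) Filter.atTop (nhds 1) := by
    simpa using ts.inv₀ one_ne_zero
  have t1 := tsi.mul (tend hprod (f := fun p => h p * f p) (by fun_prop))
  have t2 := tsi.mul (tend hprod (f := h) hc)
  rw [h3] at t2
  rw [one_mul] at t1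
  have t3 := (t2.const_sub 1).const_mul C
  simp only [mul_one, sub_self, mul_zero] at t3
  have t4 : Filter.Tendsto (fun n => ∫ p, f p ∂(Λn n : Measure (S × A)) - (s n)⁻¹ * ∫ p, h p * f p
      ∂(((μn n).prod (ζn n) : ProbabilityMeasure (S × A)) : Measure (S × A))) Filter.atTop
      (nhds 0) := by
    refine squeeze_zero_norm (fun n => ?_) t3
    have := m3 n f C hf hC
    simp only [mul_assoc, integral_const_mul] at this
    exact this
  simpa using t4.add t1

theorem aux_limit {S A : Type*}
    [MetricSpace S] [CompactSpace S] [MeasurableSpace S] [BorelSpace S]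
    [MetricSpace A] [CompactSpace A] [MeasurableSpace A] [BorelSpace A]
    (μ : ProbabilityMeasure S) (ζ : ProbabilityMeasure A)
    (Λ : ProbabilityMeasure (S × A))
    (hΛ1 : (Λ : Measure (S × A)).map Prod.fst = (μ : Measure S))
    (hΛ2 : (Λ : Measure (S × A)).map Prod.snd = (ζ : Measure A))
    (μn : ℕ → ProbabilityMeasure S) (ζn : ℕ → ProbabilityMeasure A)
    (hμ : Filter.Tendsto μn Filter.atTop (nhds μ))
    (hζ : Filter.Tendsto ζn Filter.atTop (nhds ζ)) (ε : ℝ) (hε : 0 < ε) :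
    ∃ Λn : ℕ → ProbabilityMeasure (S × A),
      (∀ n, (Λn n : Measure (S × A)).map Prod.fst = (μn n : Measure S) ∧
            (Λn n : Measure (S × A)).map Prod.snd = (ζn n : Measure A)) ∧
      ∀ (f : S × A → ℝ) (η : ℝ), Continuous f →
        (∀ p p' : S × A, dist p p' < ε → |f p - f p'| ≤ η) → ∃ l,
        Filter.Tendsto (fun n => ∫ p, f p ∂(Λn n : Measure (S × A))) Filter.atTop (nhds l) ∧
        |l - ∫ p, f p ∂(Λ : Measure (S × A))| ≤ 2 * η := by
  obtain ⟨t, φ, φc, φ0, φ1, φd⟩ := aux_pou (X := S) ε hε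
  obtain ⟨u, ψ, ψc, ψ0, ψ1, ψd⟩ := aux_pou (X := A) ε hε
  set P : Measure (S × A) := ((μ.prod ζ : ProbabilityMeasure (S × A)) : Measure (S × A)) with hP
  have hPe : P = (μ : Measure S).prod (ζ : Measure A) := rfl
  let w : t → u → S × A → ℝ := fun i j p => φ i p.1 * ψ j p.2
  have wc : ∀ i j, Continuous (w i j) := fun i j => by fun_prop
  have w0 : ∀ i j p, 0 ≤ w i j p := fun i j p => mul_nonneg (φ0 _ _) (ψ0 _ _)
  let L : t → u → ℝ := fun i j => ∫ p, w i j p ∂(Λ : Measure (S × A))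
  let P1 : t → ℝ := fun i => ∫ x, φ i x ∂(μ : Measure S)
  let Q1 : u → ℝ := fun j => ∫ y, ψ j y ∂(ζ : Measure A)
  have L0 : ∀ i j, 0 ≤ L i j := fun i j => integral_nonneg (w0 i j)
  have P0 : ∀ i, 0 ≤ P1 i := fun i => integral_nonneg (φ0 i)
  have Q0 : ∀ i, 0 ≤ Q1 i := fun i => integral_nonneg (ψ0 i)
  have LP : ∀ i, ∑ j, L i j = P1 i := by
    intro i
    simp only [L, P1]
    rw [← integral_finsetSum _ fun j _ => aux_int _ (wc i j), ← hΛ1,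
      integral_map measurable_fst.aemeasurable (φc i).aestronglyMeasurable]
    simp only [w, ← Finset.mul_sum, ψ1, mul_one]
  have LQ : ∀ j, ∑ i, L i j = Q1 j := by
    intro j
    simp only [L, Q1]
    rw [← integral_finsetSum _ fun i _ => aux_int _ (wc i j), ← hΛ2,
      integral_map measurable_snd.aemeasurable (ψc j).aestronglyMeasurable]
    simp only [w, ← Finset.sum_mul, φ1, one_mul]
  have wP : ∀ i j, ∫ p, w i j p ∂P = P1 i * Q1 j := fun i j => by
    rw [hPe]; exact integral_prod_mul _ _
  let c : t → u → ℝ := fun i j => L i j / (P1 i * Q1 j)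
  have c0 : ∀ i j, 0 ≤ c i j := fun i j => div_nonneg (L0 i j) (mul_nonneg (P0 i) (Q0 j))
  have Lz1 : ∀ i j, P1 i = 0 → L i j = 0 := fun i j h => by
    have e := Finset.single_le_sum (f := fun j => L i j) (fun j _ => L0 i j) (Finset.mem_univ j)
    rw [LP, h] at e
    exact le_antisymm e (L0 i j)
  have Lz2 : ∀ i j, Q1 j = 0 → L i j = 0 := fun i j h => by
    have e := Finset.single_le_sum (f := fun i => L i j) (fun i _ => L0 i j) (Finset.mem_univ i)
    rw [LQ, h] at e
    exact le_antisymm e (L0 i j)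
  have cQ : ∀ i j, c i j * Q1 j = L i j / P1 i := fun i j => by
    by_cases h : Q1 j = 0
    · simp [h, Lz2 i j h]
    · simp only [c]; rw [← div_div, div_mul_cancel₀ _ h]
  have cP : ∀ i j, c i j * P1 i = L i j / Q1 j := fun i j => by
    by_cases h : P1 i = 0
    · simp [h, Lz1 i j h]
    · simp only [c]; rw [mul_comm (P1 i), ← div_div, div_mul_cancel₀ _ h]
  have cPQ : ∀ i j, c i j * (P1 i * Q1 j) = L i j := fun i j => by
    by_cases h : P1 i = 0
    · simp [h, Lz1 i j h]
    · rw [mul_comm (P1 i), ← mul_assoc, cQ, div_mul_cancel₀ _ h]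
  have Lsum : ∑ i, ∑ j, L i j = 1 := by
    simp only [LP, P1]
    rw [← integral_finsetSum _ fun i _ => aux_int _ (φc i)]
    simp only [φ1]
    simp
  have expand : ∀ (Q : Measure (S × A)) [IsFiniteMeasure Q] (d : t → u → ℝ) (f : S × A → ℝ),
      Continuous f → ∫ p, (∑ i, ∑ j, d i j * w i j p) * f p ∂Q =
        ∑ i, ∑ j, d i j * ∫ p, w i j p * f p ∂Q := by
    intro Q _ d f hf
    simp only [Finset.sum_mul]
    rw [integral_finsetSum _ fun i _ => aux_int _ (by fun_prop)]
    refine Finset.sum_congr rfl fun i _ => ?_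
    rw [integral_finsetSum _ fun i _ => aux_int _ (by fun_prop)]
    refine Finset.sum_congr rfl fun j _ => ?_
    simp only [mul_assoc]
    rw [integral_const_mul]
  obtain ⟨Λn, k1, k2⟩ := aux_seq μ ζ μn ζn hμ hζ φ ψ φc ψc φ0 ψ0 φ1 ψ1 c c0
    (fun i => by
      change ∑ j, c i j * Q1 j ≤ 1
      simp only [cQ]
      rw [← Finset.sum_div, LP]; exact div_self_le_one _)
    (fun j => by
      change ∑ i, c i j * P1 i ≤ 1
      simp only [cP]
      rw [← Finset.sum_div, LQ]; exact div_self_le_one _)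
    (by
      have := expand P c (fun _ => 1) continuous_const
      simp only [mul_one, wP, cPQ, Lsum] at this
      exact this)
  refine ⟨Λn, k1, fun f η hf hη => ⟨_, k2 f hf, ?_⟩⟩
  have eP := expand P c f hf
  have eΛ := expand (Λ : Measure (S × A)) (fun _ _ => 1) f hf
  have wsum : ∀ p, ∑ i, ∑ j, w i j p = 1 := fun p => by
    simp only [w, ← Finset.mul_sum, ψ1, mul_one, φ1]
  simp only [one_mul, wsum] at eΛ
  change |∫ p, (∑ i, ∑ j, c i j * w i j p) * f p ∂P - _| ≤ _
  rw [eP, eΛ, ← Finset.sum_sub_distrib]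
  simp only [← Finset.sum_sub_distrib]
  have cell : ∀ i j, |c i j * ∫ p, w i j p * f p ∂P - ∫ p, w i j p * f p ∂(Λ : Measure (S × A))|
      ≤ 2 * η * L i j := by
    intro i j
    obtain ⟨v, hv⟩ : ∃ v, ∀ p, w i j p ≠ 0 → |f p - v| ≤ η := by
      by_cases hz : ∃ p₀, w i j p₀ ≠ 0
      · obtain ⟨p₀, hp₀⟩ := hz
        refine ⟨f p₀, fun p hp => hη _ _ ?_⟩
        have A1 := mul_ne_zero_iff.1 hp
        have A2 := mul_ne_zero_iff.1 hp₀
        rw [Prod.dist_eq]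
        exact max_lt (φd i _ _ A1.1 A2.1) (ψd j _ _ A1.2 A2.2)
      · push Not at hz
        exact ⟨0, fun p hp => absurd (hz p) hp⟩
    have A1 := aux_cell P (wc i j) hf (w0 i j) v η hv
    have A2 := aux_cell (Λ : Measure (S × A)) (wc i j) hf (w0 i j) v η hv
    rw [wP] at A1
    have A3 := mul_le_mul_of_nonneg_left A1 (c0 i j)
    rw [← abs_of_nonneg (c0 i j), ← abs_mul, abs_of_nonneg (c0 i j)] at A3
    have e1 : c i j * (∫ p, w i j p * f p ∂P - v * (P1 i * Q1 j)) =
        c i j * ∫ p, w i j p * f p ∂P - v * L i j := by rw [← cPQ]; ring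
    have e2 : c i j * (η * (P1 i * Q1 j)) = η * L i j := by rw [← cPQ]; ring
    rw [e1, e2] at A3
    change |_ - v * L i j| ≤ η * L i j at A2
    rw [abs_le] at *
    constructor <;> linarith [A2.1, A2.2, A3.1, A3.2]
  calc _ ≤ ∑ i, ∑ j, 2 * η * L i j :=
        (Finset.abs_sum_le_sum_abs _ _).trans (Finset.sum_le_sum fun i _ =>
          (Finset.abs_sum_le_sum_abs _ _).trans (Finset.sum_le_sum fun j _ => cell i j))
    _ = 2 * η := by simp only [← Finset.mul_sum, Lsum, mul_one]

/-- lower hemicontinuity of the coupling correspondence. If `Λ` is a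
coupling of `(μ, ζ)` and `(μⁿ, ζⁿ) → (μ, ζ)` weakly, then there exist couplings `Λⁿ`
of `(μⁿ, ζⁿ)` with `Λⁿ → Λ` weakly. -/
theorem stmt_5 {S A : Type*}
    [MetricSpace S] [CompactSpace S] [MeasurableSpace S] [BorelSpace S]
    [MetricSpace A] [CompactSpace A] [MeasurableSpace A] [BorelSpace A]
    (μ : ProbabilityMeasure S) (ζ : ProbabilityMeasure A)
    (Λ : ProbabilityMeasure (S × A))
    (hΛ1 : (Λ : Measure (S × A)).map Prod.fst = (μ : Measure S))
    (hΛ2 : (Λ : Measure (S × A)).map Prod.snd = (ζ : Measure A))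
    (μn : ℕ → ProbabilityMeasure S) (ζn : ℕ → ProbabilityMeasure A)
    (hμ : Filter.Tendsto μn Filter.atTop (nhds μ))
    (hζ : Filter.Tendsto ζn Filter.atTop (nhds ζ)) :
    ∃ Λn : ℕ → ProbabilityMeasure (S × A),
      (∀ n, (Λn n : Measure (S × A)).map Prod.fst = (μn n : Measure S) ∧
            (Λn n : Measure (S × A)).map Prod.snd = (ζn n : Measure A)) ∧
      Filter.Tendsto Λn Filter.atTop (nhds Λ) := by
  choose Λk k1 k2 using fun k : ℕ => aux_limit μ ζ Λ hΛ1 hΛ2 μn ζn hμ hζ (1 / ((k : ℝ) + 1))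
    Nat.one_div_pos_of_nat
  have curry : Filter.Tendsto (fun q : ℕ × ℕ => Λk q.1 q.2) (Filter.atTop.curry Filter.atTop)
      (nhds Λ) := by
    rw [ProbabilityMeasure.tendsto_iff_forall_integral_tendsto]
    intro f
    rw [Metric.tendsto_nhds]
    intro r hr
    rw [Filter.eventually_curry_iff]
    obtain ⟨δ, hδ, hfd⟩ := Metric.uniformContinuous_iff.1
      (CompactSpace.uniformContinuous_of_continuous f.continuous) (r / 4) (by positivity)
    obtain ⟨N, hN⟩ := exists_nat_one_div_lt hδ
    filter_upwards [Filter.eventually_ge_atTop N] with k hk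
    obtain ⟨l, hl, hl'⟩ := k2 k f (r / 4) f.continuous (fun p p' hp => by
      have : (1 : ℝ) / (k + 1) ≤ 1 / (N + 1) := Nat.one_div_le_one_div hk
      exact (hfd (hp.trans (this.trans_lt hN))).le)
    filter_upwards [Metric.tendsto_nhds.1 hl (r / 2) (by positivity)] with n hn
    rw [← Real.dist_eq] at hl'
    linarith [dist_triangle (∫ p, f p ∂(Λk k n : Measure (S × A))) l
      (∫ p, f p ∂(Λ : Measure (S × A)))]
  letI : PseudoMetricSpace (ProbabilityMeasure (S × A)) :=
    TopologicalSpace.pseudoMetrizableSpacePseudoMetric _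
  let K : ℕ → Set (ProbabilityMeasure (S × A)) := fun n =>
    {Q | (Q : Measure (S × A)).map Prod.fst = (μn n : Measure S) ∧
            (Q : Measure (S × A)).map Prod.snd = (ζn n : Measure A)}
  have Kne : ∀ n, (K n).Nonempty := fun n => ⟨Λk 0 n, k1 0 n⟩
  have ch : ∀ n : ℕ, ∃ Q ∈ K n, dist Λ Q < Metric.infDist Λ (K n) + 1 / ((n : ℝ) + 1) := fun n =>
    (Metric.infDist_lt_iff (Kne n)).1 (by
      have : 0 < 1 / ((n : ℝ) + 1) := Nat.one_div_pos_of_nat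
      linarith)
  choose Q hQ hd using ch
  refine ⟨Q, hQ, ?_⟩
  have hinf : Filter.Tendsto (fun n => Metric.infDist Λ (K n)) Filter.atTop (nhds 0) := by
    rw [Metric.tendsto_nhds]
    intro r hr
    have := Filter.eventually_curry_iff.1
      (Metric.tendsto_nhds.1 curry r hr)
    obtain ⟨k, hk⟩ := this.exists
    filter_upwards [hk] with n hn
    rw [Real.dist_eq, sub_zero, abs_of_nonneg Metric.infDist_nonneg]
    rw [dist_comm] at hn
    exact (Metric.infDist_le_dist_of_mem (show Λk k n ∈ K n from k1 k n)).trans_lt hn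
  rw [tendsto_iff_dist_tendsto_zero]
  refine squeeze_zero (fun _ => dist_nonneg) (fun n => ?_)
    (by simpa using hinf.add (tendsto_one_div_add_atTop_nhds_zero_nat (𝕜 := ℝ)))
  rw [dist_comm]
  simpa using (hd n).le
end
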